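/- Let S and A be finite nonempty sets, P a transition kernel on (S,A), r : S × A → ℝ a reward, γ ∈ (0,1), and ω ∈ [0,1]. Then the robust Bellman operator T_{P,ω} is a γ-contraction in the sup norm: for all Q_1, Q_2 : S × A → ℝ, ‖T_{P,ω} Q_1 − T_{P,ω} Q_2‖_∞ ≤ γ ‖Q_1 − Q_2‖_∞. -/

import Mathlib

open Finset

/-- `P` is a transition kernel on `(S, A)`: nonnegative entries and each
`P (s) (a) (·)` sums to one. -/
def IsKernel {S A : Type*} [Fintype S] (P : S → A → S → ℝ) : Prop :=
  (∀ s a s', 0 ≤ P s a s') ∧ (∀ s a, ∑ s', P s a s' = 1)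

/-- `max_{a'} Q(s, a')` over the finite nonempty action set. -/
noncomputable def maxA {S A : Type*} [Fintype A] [Nonempty A] (Q : S → A → ℝ) (s : S) : ℝ :=
  Finset.univ.sup' Finset.univ_nonempty (Q s)

open scoped Classical in
/-- The neighboring set `N_P^s = { s' : ∑_a P(s'|s,a) ≠ 0 }`. -/
noncomputable def nbr {S A : Type*} [Fintype S] [Fintype A] (P : S → A → S → ℝ) (s : S) :
    Finset S :=
  Finset.univ.filter (fun s' => ∑ a, P s a s' ≠ 0)

/-- The robust Bellman operator `T_{P,ω}`. The minimum over the (nonempty, finite)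
neighboring set is expressed via `sInf` of the image. -/
noncomputable def bellman {S A : Type*} [Fintype S] [Fintype A] [Nonempty A]
    (P : S → A → S → ℝ) (r : S → A → ℝ) (γ ω : ℝ) (Q : S → A → ℝ) : S → A → ℝ :=
  fun s a => r s a + γ * ((1 - ω) * ∑ s', P s a s' * maxA Q s'
    + ω * sInf ((fun s' => maxA Q s') '' (nbr P s : Set S)))

/-- The sup norm `‖Q‖_∞ = max_{(s,a)} |Q(s,a)|`. -/
noncomputable def supNorm {S A : Type*} [Fintype S] [Fintype A] [Nonempty S] [Nonempty A]
    (Q : S → A → ℝ) : ℝ :=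
  Finset.univ.sup' Finset.univ_nonempty (fun p : S × A => |Q p.1 p.2|)

theorem abs_le_supNorm {S A : Type*} [Fintype S] [Fintype A] [Nonempty S] [Nonempty A]
    (Q : S → A → ℝ) (s : S) (a : A) : |Q s a| ≤ supNorm Q :=
  Finset.le_sup' (fun p : S × A => |Q p.1 p.2|) (Finset.mem_univ (s, a))

theorem supNorm_le_iff {S A : Type*} [Fintype S] [Fintype A] [Nonempty S] [Nonempty A]
    {Q : S → A → ℝ} {c : ℝ} : supNorm Q ≤ c ↔ ∀ s a, |Q s a| ≤ c := by
  simp [supNorm]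

theorem maxA_le_maxA_add {S A : Type*} [Fintype A] [Nonempty A] {Q₁ Q₂ : S → A → ℝ} {c : ℝ}
    {s : S} (h : ∀ a, Q₁ s a ≤ Q₂ s a + c) : maxA Q₁ s ≤ maxA Q₂ s + c :=
  Finset.sup'_le _ _ fun a ha =>
    (h a).trans (add_le_add_left (Finset.le_sup' (Q₂ s) ha) c)

theorem sInf_image_le_sInf_image_add {ι : Type*} (t : Finset ι) {f g : ι → ℝ} {c : ℝ}
    (hc : 0 ≤ c) (h : ∀ i, f i ≤ g i + c) :
    sInf (f '' (t : Set ι)) ≤ sInf (g '' (t : Set ι)) + c := by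
  rcases t.eq_empty_or_nonempty with rfl | ht
  · simpa using hc
  · rw [← sub_le_iff_le_add]
    refine le_csInf (ht.to_set.image g) ?_
    rintro _ ⟨i, hi, rfl⟩
    rw [sub_le_iff_le_add]
    exact (csInf_le (t.finite_toSet.image f).bddBelow ⟨i, hi, rfl⟩).trans (h i)

theorem bellman_le_bellman_add {S A : Type*} [Fintype S] [Fintype A] [Nonempty A]
    {P : S → A → S → ℝ} (hP : IsKernel P) (r : S → A → ℝ) {γ ω c : ℝ} (hγ : 0 ≤ γ)
    (hω0 : 0 ≤ ω) (hω1 : ω ≤ 1) (hc : 0 ≤ c) {Q₁ Q₂ : S → A → ℝ}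
    (h : ∀ s a, Q₁ s a ≤ Q₂ s a + c) (s : S) (a : A) :
    bellman P r γ ω Q₁ s a ≤ bellman P r γ ω Q₂ s a + γ * c := by
  have hmax (s' : S) : maxA Q₁ s' ≤ maxA Q₂ s' + c := maxA_le_maxA_add (h s')
  have hsum : ∑ s', P s a s' * maxA Q₁ s' ≤ ∑ s', P s a s' * maxA Q₂ s' + c :=
    calc ∑ s', P s a s' * maxA Q₁ s'
        ≤ ∑ s', P s a s' * (maxA Q₂ s' + c) :=
          Finset.sum_le_sum fun s' _ => mul_le_mul_of_nonneg_left (hmax s') (hP.1 s a s')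
      _ = ∑ s', P s a s' * maxA Q₂ s' + c := by
          simp only [mul_add, Finset.sum_add_distrib, ← Finset.sum_mul, hP.2, one_mul]
  have hinf := sInf_image_le_sInf_image_add (nbr P s) hc hmax
  have hmix := mul_le_mul_of_nonneg_left
    (add_le_add (mul_le_mul_of_nonneg_left hsum (sub_nonneg.2 hω1))
      (mul_le_mul_of_nonneg_left hinf hω0)) hγ
  unfold bellman
  linarith

/-- The robust Bellman operator is a γ-contraction in sup norm. -/
theorem robust_bellman_contraction
    {S A : Type*} [Fintype S] [Fintype A] [Nonempty S] [Nonempty A]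
    (P : S → A → S → ℝ) (hP : IsKernel P)
    (r : S → A → ℝ) (γ ω : ℝ) (hγ0 : 0 < γ) (hγ1 : γ < 1) (hω0 : 0 ≤ ω) (hω1 : ω ≤ 1)
    (Q₁ Q₂ : S → A → ℝ) :
    supNorm (bellman P r γ ω Q₁ - bellman P r γ ω Q₂) ≤ γ * supNorm (Q₁ - Q₂) := by
  have hdiff (s : S) (a : A) := abs_le.1 (abs_le_supNorm (Q₁ - Q₂) s a)
  simp only [Pi.sub_apply] at hdiff
  have hc : 0 ≤ supNorm (Q₁ - Q₂) :=
    (abs_nonneg _).trans (abs_le_supNorm _ (Classical.arbitrary S) (Classical.arbitrary A))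
  refine supNorm_le_iff.2 fun s a => ?_
  have h₁ := bellman_le_bellman_add hP r hγ0.le hω0 hω1 hc
    (fun s a => by linarith [(hdiff s a).2] : ∀ s a, Q₁ s a ≤ Q₂ s a + _) s a
  have h₂ := bellman_le_bellman_add hP r hγ0.le hω0 hω1 hc
    (fun s a => by linarith [(hdiff s a).1] : ∀ s a, Q₂ s a ≤ Q₁ s a + _) s a
  simp only [Pi.sub_apply]
  exact abs_le.2 ⟨by linarith, by linarith⟩
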